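/- (Kernel-based Retinex increases brightness.) Let I : X → ℝ be an image on a finite pixel domain X taking values in (0,1], let ω : X × X → ℝ be nonnegative weights with Σ_{y ∈ X} ω(x,y) = 1 for each x, and let f : ℝ → ℝ satisfy f(r) ≥ r for all r ∈ (0,1]. Define the kernel-based Retinex lightness l(x) = Σ_{y : I(y) ≥ I(x)} ω(x,y)·f(I(x)/I(y)) + Σ_{y : I(y) < I(x)} ω(x,y). Then l(x) ≥ I(x) for every pixel x. -/

import Mathlib

open Finset

/-- Kernel-based Retinex increases brightness. -/
theorem kernel_retinex_increases_brightness {X : Type*} [Fintype X]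
    (I : X → ℝ) (hI : ∀ x, 0 < I x ∧ I x ≤ 1)
    (ω : X → X → ℝ) (hω : ∀ x y, 0 ≤ ω x y)
    (hsum : ∀ x, ∑ y : X, ω x y = 1)
    (f : ℝ → ℝ) (hf : ∀ r : ℝ, 0 < r → r ≤ 1 → r ≤ f r)
    (x : X) :
    I x ≤ (∑ y ∈ univ.filter (fun y => I x ≤ I y), ω x y * f (I x / I y))
        + ∑ y ∈ univ.filter (fun y => I y < I x), ω x y := by
  have h1 : I x = ∑ y : X, ω x y * I x := by
    rw [← Finset.sum_mul, hsum, one_mul]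
  have h2 := Finset.sum_filter_add_sum_filter_not univ (fun y => I x ≤ I y)
    (fun y => ω x y * I x)
  simp only [not_le] at h2
  rw [← h2] at h1
  refine h1.le.trans (add_le_add (Finset.sum_le_sum ?_) (Finset.sum_le_sum ?_))
  · intro y hy
    have hxy : I x ≤ I y := (Finset.mem_filter.mp hy).2
    refine mul_le_mul_of_nonneg_left ?_ (hω x y)
    refine le_trans ?_ (hf _ (div_pos (hI x).1 (hI y).1) ((div_le_one (hI y).1).2 hxy))
    exact le_div_self (hI x).1.le (hI y).1 (hI y).2
  · intro y _
    exact mul_le_of_le_one_right (hω x y) (hI x).2
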